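/- arXiv:1201.2670 — 3 statements merged into one kernel-verified Lean document; each statement's English description precedes it below -/
import Mathlib

section
/- Assume n is odd. The map diag(λ, m, λ⁻¹) ↦ λ⁻¹m is a group isomorphism from SP₀^line, the group of block-diagonal matrices diag(λ, m, λ⁻¹) (blocks of sizes 1, n, 1) with λ ∈ ℝ∖{0} and m ∈ SO(p,q), onto CO(p,q). -/
open Matrix

noncomputable section

/-- Square real matrices of size `m`. -/
abbrev Mat (m : ℕ) := Matrix (Fin m) (Fin m) ℝ

/-- Signs of the diagonal quadratic form of signature `(p,q)`:
`+1` for the first `p` coordinates, `-1` for the remaining ones. -/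
def sgn (p i : ℕ) : ℝ := if i < p then 1 else -1

/-- The quadratic form `Q(x) = 2 x₀ x_{n+1} + Σ_{i=1}^{p} x_i² − Σ_{i=p+1}^{n} x_i²`
on `ℝ^{n+2}`, where `n = p + q`. -/
def Qf (p q : ℕ) (x : Fin (p + q + 2) → ℝ) : ℝ :=
  2 * x ⟨0, by omega⟩ * x ⟨p + q + 1, by omega⟩ +
    ∑ i : Fin (p + q), sgn p i * x ⟨(i : ℕ) + 1, by have := i.isLt; omega⟩ ^ 2

/-- The quadratic form `h(y) = Σ_{i=1}^{p} y_i² − Σ_{i=p+1}^{n} y_i²` on `ℝⁿ`, `n = p + q`. -/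
def hf (p q : ℕ) (y : Fin (p + q) → ℝ) : ℝ := ∑ i : Fin (p + q), sgn p i * y i ^ 2

/-- `O(Q)`: the invertible `(n+2) × (n+2)` real matrices preserving `Q`. -/
def OQ (p q : ℕ) : Set (Mat (p + q + 2)) :=
  {A | IsUnit A ∧ ∀ x, Qf p q (A *ᵥ x) = Qf p q x}

/-- `SO(Q) = O(Q) ∩ SL(n+2,ℝ)`. -/
def SOQ (p q : ℕ) : Set (Mat (p + q + 2)) := {A | A ∈ OQ p q ∧ A.det = 1}

/-- `O(p,q)`: the invertible `n × n` real matrices preserving `h`. -/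
def Opq (p q : ℕ) : Set (Mat (p + q)) :=
  {m | IsUnit m ∧ ∀ y, hf p q (m *ᵥ y) = hf p q y}

/-- `SO(p,q) = O(p,q) ∩ SL(n,ℝ)`. -/
def SOpq (p q : ℕ) : Set (Mat (p + q)) := {m | m ∈ Opq p q ∧ m.det = 1}

/-- `CO(p,q) = {c m : c > 0, m ∈ O(p,q)}`. -/
def COpq (p q : ℕ) : Set (Mat (p + q)) :=
  {B | ∃ c : ℝ, 0 < c ∧ ∃ m ∈ Opq p q, B = c • m}

/-- `CSO(p,q) = {c m : c > 0, m ∈ SO(p,q)}`. -/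
def CSOpq (p q : ℕ) : Set (Mat (p + q)) :=
  {B | ∃ c : ℝ, 0 < c ∧ ∃ m ∈ SOpq p q, B = c • m}

/-- `S` is a subgroup of `T` (as sets of matrices): `S ⊆ T`, `S` contains the identity and is
closed under multiplication and inverses. -/
def IsMatSubgroupOf {m : ℕ} (S T : Set (Mat m)) : Prop :=
  S ⊆ T ∧ (1 : Mat m) ∈ S ∧ (∀ A ∈ S, ∀ B ∈ S, A * B ∈ S) ∧ ∀ A ∈ S, A⁻¹ ∈ S

/-- The block-diagonal matrix `diag(λ, m, λ⁻¹)` with blocks of sizes `1`, `n`, `1`. -/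
def blk (p q : ℕ) (lam : ℝ) (m : Mat (p + q)) : Mat (p + q + 2) := fun i j =>
  if hi : (i : ℕ) = 0 then (if (j : ℕ) = 0 then lam else 0)
  else if hi' : (i : ℕ) = p + q + 1 then (if (j : ℕ) = p + q + 1 then lam⁻¹ else 0)
  else if hj : 1 ≤ (j : ℕ) ∧ (j : ℕ) ≤ p + q then
    m ⟨(i : ℕ) - 1, by have := i.isLt; omega⟩ ⟨(j : ℕ) - 1, by omega⟩
  else 0

/-- The middle `n × n` block of an `(n+2) × (n+2)` matrix. -/
def mid (p q : ℕ) (A : Mat (p + q + 2)) : Mat (p + q) := fun i j =>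
  A ⟨(i : ℕ) + 1, by have := i.isLt; omega⟩ ⟨(j : ℕ) + 1, by have := j.isLt; omega⟩

/-- The map `diag(λ, m, λ⁻¹) ↦ λ⁻¹ m`, expressed on matrices as
`A ↦ (A₀₀)⁻¹ • (middle block of A)`. -/
def ad0 (p q : ℕ) (A : Mat (p + q + 2)) : Mat (p + q) :=
  (A ⟨0, by omega⟩ ⟨0, by omega⟩)⁻¹ • mid p q A

/-- `P₀^ray`: block-diagonal matrices `diag(λ, m, λ⁻¹)` with `λ > 0`, `m ∈ O(p,q)`. -/
def P0ray (p q : ℕ) : Set (Mat (p + q + 2)) :=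
  {A | ∃ lam : ℝ, 0 < lam ∧ ∃ m ∈ Opq p q, A = blk p q lam m}

/-- `P₀^line`: block-diagonal matrices `diag(λ, m, λ⁻¹)` with `λ ≠ 0`, `m ∈ O(p,q)`. -/
def P0line (p q : ℕ) : Set (Mat (p + q + 2)) :=
  {A | ∃ lam : ℝ, lam ≠ 0 ∧ ∃ m ∈ Opq p q, A = blk p q lam m}

/-- `SP₀^ray`: block-diagonal matrices `diag(λ, m, λ⁻¹)` with `λ > 0`, `m ∈ SO(p,q)`. -/
def SP0ray (p q : ℕ) : Set (Mat (p + q + 2)) :=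
  {A | ∃ lam : ℝ, 0 < lam ∧ ∃ m ∈ SOpq p q, A = blk p q lam m}

/-- `SP₀^line`: block-diagonal matrices `diag(λ, m, λ⁻¹)` with `λ ≠ 0`, `m ∈ SO(p,q)`. -/
def SP0line (p q : ℕ) : Set (Mat (p + q + 2)) :=
  {A | ∃ lam : ℝ, lam ≠ 0 ∧ ∃ m ∈ SOpq p q, A = blk p q lam m}

theorem blk_zero_zero (p q : ℕ) (lam : ℝ) (m : Mat (p + q)) :
    blk p q lam m ⟨0, by omega⟩ ⟨0, by omega⟩ = lam := by
  simp [blk]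

theorem mid_blk (p q : ℕ) (lam : ℝ) (m : Mat (p + q)) : mid p q (blk p q lam m) = m := by
  ext i j
  have hi := i.isLt
  have hj := j.isLt
  have h1 : (i : ℕ) ≠ p + q := by omega
  have h2 : (j : ℕ) + 1 ≤ p + q := by omega
  simp [mid, blk, h1, h2]

theorem ad0_blk (p q : ℕ) (lam : ℝ) (m : Mat (p + q)) : ad0 p q (blk p q lam m) = lam⁻¹ • m := by
  rw [ad0, blk_zero_zero, mid_blk]

theorem sum_fin_add_two {n : ℕ} (f : Fin (n + 2) → ℝ) :
    ∑ k, f k = f ⟨0, by omega⟩ + ∑ k : Fin n, f ⟨(k : ℕ) + 1, by omega⟩ +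
      f ⟨n + 1, by omega⟩ := by
  rw [Fin.sum_univ_succ, Fin.sum_univ_castSucc, ← add_assoc]
  rfl

theorem blk_mul_zero_zero (p q : ℕ) (lam mu : ℝ) (m m' : Mat (p + q)) :
    (blk p q lam m * blk p q mu m') ⟨0, by omega⟩ ⟨0, by omega⟩ = lam * mu := by
  rw [Matrix.mul_apply, sum_fin_add_two]
  simp [blk]

theorem mid_blk_mul (p q : ℕ) (lam mu : ℝ) (m m' : Mat (p + q)) :
    mid p q (blk p q lam m * blk p q mu m') = m * m' := by
  ext i j
  have hi : (i : ℕ) ≠ p + q := by have := i.isLt; omega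
  have hj : (j : ℕ) ≠ p + q := by have := j.isLt; omega
  have key (M : Mat (p + q)) (c : ℝ) (a b : Fin (p + q)) :
      blk p q c M ⟨(a : ℕ) + 1, by omega⟩ ⟨(b : ℕ) + 1, by omega⟩ = M a b :=
    congrFun₂ (mid_blk p q c M) a b
  rw [mid, Matrix.mul_apply, Matrix.mul_apply, sum_fin_add_two]
  simp only [key]
  simp [blk, hi, hj]

theorem hf_add (p q : ℕ) (x y : Fin (p + q) → ℝ) :
    hf p q (x + y) = hf p q x + hf p q y + 2 * ∑ i : Fin (p + q), sgn p i * (x i * y i) := by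
  simp only [hf, Pi.add_apply, Finset.mul_sum, ← Finset.sum_add_distrib]
  exact Finset.sum_congr rfl fun i _ => by ring

theorem transpose_mul_diagonal_mul_of_mem_Opq {p q : ℕ} {m : Mat (p + q)} (hm : m ∈ Opq p q) :
    mᵀ * diagonal (fun i : Fin (p + q) => sgn p i) * m =
      diagonal (fun i : Fin (p + q) => sgn p i) := by
  have polar (x y : Fin (p + q) → ℝ) :
      ∑ i : Fin (p + q), sgn p i * ((m *ᵥ x) i * (m *ᵥ y) i) =
        ∑ i : Fin (p + q), sgn p i * (x i * y i) := by
    have h := hm.2 (x + y)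
    rw [Matrix.mulVec_add, hf_add, hf_add, hm.2, hm.2] at h
    linarith
  ext i j
  have h := polar (Pi.single i 1) (Pi.single j 1)
  simp only [Matrix.mulVec_single_one, Matrix.col_apply] at h
  rw [Matrix.mul_apply]
  simp only [Matrix.mul_diagonal, Matrix.transpose_apply]
  rw [Finset.sum_congr rfl fun k _ => show m k i * sgn p k * m k j =
    sgn p k * (m k i * m k j) by ring, h]
  by_cases hij : i = j
  · subst hij
    simp [Pi.single_apply]
  · rw [Matrix.diagonal_apply_ne _ hij]
    refine Finset.sum_eq_zero fun k _ => ?_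
    by_cases hk : k = i
    · subst hk
      simp [hij]
    · simp [hk]

theorem det_eq_one_or_neg_one_of_mem_Opq {p q : ℕ} {m : Mat (p + q)} (hm : m ∈ Opq p q) :
    m.det = 1 ∨ m.det = -1 := by
  have h := congrArg Matrix.det (transpose_mul_diagonal_mul_of_mem_Opq hm)
  have hd : (diagonal (fun i : Fin (p + q) => sgn p i)).det ≠ 0 := by
    rw [Matrix.det_diagonal, Finset.prod_ne_zero_iff]
    intro i _
    unfold sgn
    split_ifs <;> norm_num
  rw [Matrix.det_mul, Matrix.det_mul, Matrix.det_transpose] at h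
  rw [← mul_self_eq_one_iff]
  apply mul_right_cancel₀ hd
  linarith

theorem neg_mem_Opq {p q : ℕ} {m : Mat (p + q)} (hm : m ∈ Opq p q) : -m ∈ Opq p q := by
  refine ⟨hm.1.neg, fun y => ?_⟩
  rw [← hm.2 y, Matrix.neg_mulVec]
  simp [hf]

/-- for `n = p + q` odd, `diag(λ, m, λ⁻¹) ↦ λ⁻¹ m` is a group isomorphism
from `SP₀^line` onto `CO(p,q)`. -/
theorem stmt5 (p q : ℕ) (hn : Odd (p + q)) :
    Set.BijOn (ad0 p q) (SP0line p q) (COpq p q) ∧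
    ∀ A ∈ SP0line p q, ∀ B ∈ SP0line p q, ad0 p q (A * B) = ad0 p q A * ad0 p q B := by
  refine ⟨⟨?_, ?_, ?_⟩, ?_⟩
  · rintro _ ⟨lam, hlam, m, hm, rfl⟩
    rw [ad0_blk]
    rcases lt_or_gt_of_ne hlam with h | h
    · exact ⟨-lam⁻¹, neg_pos.2 (inv_lt_zero.2 h), -m, neg_mem_Opq hm.1, by simp⟩
    · exact ⟨lam⁻¹, inv_pos.2 h, m, hm.1, rfl⟩
  · rintro _ ⟨lam, hlam, m, hm, rfl⟩ _ ⟨mu, hmu, m', hm', rfl⟩ h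
    rw [ad0_blk, ad0_blk] at h
    have hdet := congrArg Matrix.det h
    rw [Matrix.det_smul, Matrix.det_smul, hm.2, hm'.2, mul_one, mul_one, Fintype.card_fin,
      hn.pow_inj] at hdet
    rw [hdet] at h
    rw [smul_right_injective _ (inv_ne_zero hmu) h, inv_injective hdet]
  · rintro _ ⟨c, hc, m, hm, rfl⟩
    rcases det_eq_one_or_neg_one_of_mem_Opq hm with hd | hd
    · exact ⟨_, ⟨c⁻¹, inv_ne_zero hc.ne', m, ⟨hm, hd⟩, rfl⟩, by rw [ad0_blk, inv_inv]⟩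
    · refine ⟨_, ⟨-c⁻¹, neg_ne_zero.2 (inv_ne_zero hc.ne'), -m, ⟨neg_mem_Opq hm, ?_⟩, rfl⟩, ?_⟩
      · rw [Matrix.det_neg, hd, Fintype.card_fin, hn.neg_one_pow]
        norm_num
      · rw [ad0_blk, inv_neg, inv_inv, neg_smul_neg]
  · rintro _ ⟨lam, hlam, m, hm, rfl⟩ _ ⟨mu, hmu, m', hm', rfl⟩
    rw [ad0_blk, ad0_blk, ad0, blk_mul_zero_zero, mid_blk_mul, smul_mul_smul_comm, mul_inv]
end
end

section
/- If A ∈ O(Q) and A e₀ = λ e₀ for some λ ∈ ℝ∖{0}, then A is block upper triangular: its last row is (0, …, 0, λ⁻¹) (i.e., A_{n+1, j} = 0 for j ≤ n and A_{n+1, n+1} = λ⁻¹), and its middle n×n block m = (A_{ij})_{1 ≤ i, j ≤ n} belongs to O(p,q). -/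
open Matrix

noncomputable section

/-- The standard basis vector `e₀` of `ℝ^{n+2}`. -/
def e0 (p q : ℕ) : Fin (p + q + 2) → ℝ := fun j => if (j : ℕ) = 0 then 1 else 0

theorem Qf_add_smul_e0 (p q : ℕ) (x : Fin (p + q + 2) → ℝ) (t : ℝ) :
    Qf p q (x + t • e0 p q) = Qf p q x + 2 * t * x ⟨p + q + 1, by omega⟩ := by
  simp only [Qf, e0, Pi.add_apply, Pi.smul_apply, smul_eq_mul, Nat.succ_ne_zero, if_true, if_false,
    mul_zero, add_zero, mul_one]
  ring

theorem hf_add_smul_single (p q : ℕ) (y : Fin (p + q) → ℝ) (i : Fin (p + q)) (t : ℝ) :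
    hf p q (y + Pi.single i t) = hf p q y + 2 * sgn p i * t * y i + sgn p i * t ^ 2 := by
  have key : ∀ j : Fin (p + q), sgn p j * (y + Pi.single i t : Fin (p + q) → ℝ) j ^ 2 =
      sgn p j * y j ^ 2 + if j = i then 2 * sgn p i * t * y i + sgn p i * t ^ 2 else 0 := by
    intro j
    by_cases hj : j = i
    · subst hj
      simp only [Pi.add_apply, Pi.single_eq_same, if_true]
      ring
    · simp [hj]
  simp only [hf, key, Finset.sum_add_distrib, Finset.sum_ite_eq', Finset.mem_univ, if_true]
  ring

theorem sgn_ne_zero (p i : ℕ) : sgn p i ≠ 0 := by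
  unfold sgn
  split_ifs <;> norm_num

/-- Since `h` is nondegenerate, a matrix preserving it is invertible. -/
theorem mem_Opq_of_preserves {p q : ℕ} {m : Mat (p + q)}
    (hm : ∀ y, hf p q (m *ᵥ y) = hf p q y) : m ∈ Opq p q := by
  refine ⟨?_, hm⟩
  rw [← Matrix.mulVec_injective_iff_isUnit]
  refine (injective_iff_map_eq_zero m.mulVecLin).2 fun y hy => funext fun i => ?_
  have hy : m *ᵥ y = 0 := hy
  have h_shift : ∀ t, hf p q (y + Pi.single i t) = hf p q (Pi.single i t) := fun t => by
    rw [← hm, Matrix.mulVec_add, hy, zero_add, hm]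
  have h_zero : ∀ t, hf p q (Pi.single i t) = sgn p i * t ^ 2 := fun t => by
    have := hf_add_smul_single p q 0 i t
    simpa [hf] using this
  have h0 := h_shift 0
  have h1 := h_shift 1
  rw [hf_add_smul_single, h_zero] at h0 h1
  have : sgn p i * y i = 0 := by linarith
  exact (mul_eq_zero.1 this).resolve_left (sgn_ne_zero p i)

/-- The inclusion `y ↦ (0, y, 0)` of `ℝⁿ` in `ℝ^{n+2}`. -/
def midVec (p q : ℕ) (y : Fin (p + q) → ℝ) : Fin (p + q + 2) → ℝ :=
  Fin.cons 0 (Fin.snoc y 0 : Fin (p + q + 1) → ℝ)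

theorem midVec_zero (p q : ℕ) (y : Fin (p + q) → ℝ) : midVec p q y ⟨0, by omega⟩ = 0 := rfl

theorem midVec_last (p q : ℕ) (y : Fin (p + q) → ℝ) :
    midVec p q y ⟨p + q + 1, by omega⟩ = 0 :=
  Fin.snoc_last (α := fun _ => ℝ) 0 y

theorem midVec_mid (p q : ℕ) (y : Fin (p + q) → ℝ) (i : Fin (p + q)) :
    midVec p q y ⟨(i : ℕ) + 1, by have := i.isLt; omega⟩ = y i :=
  Fin.snoc_castSucc (α := fun _ => ℝ) 0 y i

theorem Qf_of_last_eq_zero {p q : ℕ} {x : Fin (p + q + 2) → ℝ}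
    (hx : x ⟨p + q + 1, by omega⟩ = 0) :
    Qf p q x = hf p q fun i => x ⟨(i : ℕ) + 1, by have := i.isLt; omega⟩ := by
  simp [Qf, hf, hx]

theorem mulVec_midVec (p q : ℕ) (A : Mat (p + q + 2)) (y : Fin (p + q) → ℝ) (i : Fin (p + q)) :
    (A *ᵥ midVec p q y) ⟨(i : ℕ) + 1, by have := i.isLt; omega⟩ = (mid p q A *ᵥ y) i := by
  simp only [Matrix.mulVec, dotProduct]
  rw [Fin.sum_univ_succ, Fin.sum_univ_castSucc]
  have h0 : midVec p q y 0 = 0 := midVec_zero p q y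
  have hl : midVec p q y (Fin.last (p + q)).succ = 0 := midVec_last p q y
  have hm : ∀ j : Fin (p + q), midVec p q y j.castSucc.succ = y j := midVec_mid p q y
  simp only [h0, hl, hm, mul_zero, zero_add, add_zero]
  rfl

/-- if `A ∈ O(Q)` and `A e₀ = λ e₀` with `λ ≠ 0`, then `A` is block upper
triangular: its last row is `(0, …, 0, λ⁻¹)`, and its middle `n × n` block lies in `O(p,q)`. -/
theorem stmt15 (p q : ℕ) (A : Mat (p + q + 2)) (hA : A ∈ OQ p q) (lam : ℝ) (hlam : lam ≠ 0)
    (h : A *ᵥ e0 p q = lam • e0 p q) :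
    (∀ j : Fin (p + q + 2), (j : ℕ) ≤ p + q → A ⟨p + q + 1, by omega⟩ j = 0) ∧
    A ⟨p + q + 1, by omega⟩ ⟨p + q + 1, by omega⟩ = lam⁻¹ ∧
    mid p q A ∈ Opq p q := by
  have h_last : ∀ x : Fin (p + q + 2) → ℝ, lam * (A *ᵥ x) ⟨p + q + 1, by omega⟩ =
      x ⟨p + q + 1, by omega⟩ := fun x => by
    have hx := hA.2 (x + (1 : ℝ) • e0 p q)
    rw [Qf_add_smul_e0, one_smul, Matrix.mulVec_add, h, Qf_add_smul_e0, hA.2] at hx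
    linarith
  refine ⟨fun j hj => ?_, ?_, mem_Opq_of_preserves fun y => ?_⟩
  · have hx := h_last (Pi.single j 1)
    have hne : (⟨p + q + 1, by omega⟩ : Fin (p + q + 2)) ≠ j := by
      intro hj_eq
      have := congrArg Fin.val hj_eq
      simp only at this
      omega
    rw [Matrix.mulVec_single_one, Pi.single_eq_of_ne hne] at hx
    exact (mul_eq_zero.1 hx).resolve_left hlam
  · have hx := h_last (Pi.single ⟨p + q + 1, by omega⟩ 1)
    rw [Matrix.mulVec_single_one, Pi.single_eq_same] at hx
    exact eq_inv_of_mul_eq_one_right hx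
  · have hx := h_last (midVec p q y)
    rw [midVec_last] at hx
    have hQ := hA.2 (midVec p q y)
    rw [Qf_of_last_eq_zero ((mul_eq_zero.1 hx).resolve_left hlam),
      Qf_of_last_eq_zero (midVec_last p q y)] at hQ
    simpa only [mulVec_midVec, midVec_mid] using hQ
end
end

section
/- Assume p ≥ 1 and q ≥ 1. There is no continuous map s: N → ℝ^{n+2} such that for every v ∈ N: s(v) is a nonzero scalar multiple of v, and s(t v) = s(v) for every t ∈ ℝ∖{0}. (Equivalently, the tautological line bundle over the quadric of null lines admits no nonvanishing continuous section, i.e., is nontrivial, when pq ≠ 0.) -/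
noncomputable section

/-- The diagonal quadratic form of signature `(p+1, q+1)` on `ℝ^{n+2} = ℝ^{p+1} × ℝ^{q+1}`:
`Q̃(x, y) = |x|² − |y|²`. -/
def Qt (p q : ℕ) (z : (Fin (p + 1) → ℝ) × (Fin (q + 1) → ℝ)) : ℝ :=
  ∑ i : Fin (p + 1), z.1 i ^ 2 - ∑ j : Fin (q + 1), z.2 j ^ 2

/-- The set `N` of nonzero null vectors of `Q̃`. -/
def NullSet (p q : ℕ) : Set ((Fin (p + 1) → ℝ) × (Fin (q + 1) → ℝ)) :=
  {v | Qt p q v = 0 ∧ v ≠ 0}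

/-- The point `(cos θ, sin θ, 0, …, 0)` of the unit circle in the first coordinate plane. -/
def planeCircle (m : ℕ) (θ : ℝ) : Fin (m + 2) → ℝ :=
  Fin.cons (Real.cos θ) (Fin.cons (Real.sin θ) 0)

lemma sum_planeCircle_sq (m : ℕ) (θ : ℝ) : ∑ i, planeCircle m θ i ^ 2 = 1 := by
  simp [planeCircle, Fin.sum_univ_succ]

lemma continuous_planeCircle (m : ℕ) : Continuous (planeCircle m) := by
  refine continuous_pi fun i => ?_
  refine Fin.cases Real.continuous_cos (fun j => ?_) i
  refine Fin.cases Real.continuous_sin (fun k => ?_) j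
  exact continuous_const

lemma planeCircle_pi (m : ℕ) : planeCircle m Real.pi = (-1 : ℝ) • planeCircle m 0 := by
  funext i
  refine Fin.cases ?_ (fun j => ?_) i
  · simp [planeCircle]
  · refine Fin.cases ?_ (fun k => ?_) j <;> simp [planeCircle]

lemma planeCircle_ne_zero (m : ℕ) (θ : ℝ) : planeCircle m θ ≠ 0 := by
  intro h
  have := sum_planeCircle_sq m θ
  simp [h] at this

/-- The loop of null lines traced out by two synchronous unit circles. -/
def nullCircle (p q : ℕ) (θ : ℝ) : NullSet (p + 1) (q + 1) :=
  ⟨(planeCircle p θ, planeCircle q θ), by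
    refine ⟨?_, fun h => planeCircle_ne_zero p θ (congrArg Prod.fst h)⟩
    simp only [Qt]
    rw [sum_planeCircle_sq, sum_planeCircle_sq, sub_self]⟩

lemma continuous_nullCircle (p q : ℕ) : Continuous (nullCircle p q) :=
  ((continuous_planeCircle p).prodMk (continuous_planeCircle q)).subtype_mk _

/-- for `p, q ≥ 1` there is no continuous map `s : N → ℝ^{n+2}` such that `s(v)`
is a nonzero scalar multiple of `v` and `s(t v) = s(v)` for all `t ≠ 0` (the tautological line
bundle over the quadric of null lines admits no nonvanishing continuous section). -/
theorem stmt16 (p q : ℕ) (hp : 1 ≤ p) (hq : 1 ≤ q) :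
    ¬ ∃ s : (NullSet p q) → (Fin (p + 1) → ℝ) × (Fin (q + 1) → ℝ),
        Continuous s ∧
        (∀ v : NullSet p q, ∃ c : ℝ, c ≠ 0 ∧ s v = c • v.1) ∧
        (∀ v w : NullSet p q, (∃ t : ℝ, t ≠ 0 ∧ w.1 = t • v.1) → s w = s v) := by
  rintro ⟨s, hs, hmul, hinv⟩
  obtain ⟨p, rfl⟩ := Nat.exists_eq_add_of_le' hp
  obtain ⟨q, rfl⟩ := Nat.exists_eq_add_of_le' hq
  have hcont : Continuous fun θ => s (nullCircle p q θ) := hs.comp (continuous_nullCircle p q)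
  have hpi : s (nullCircle p q Real.pi) = s (nullCircle p q 0) := by
    refine hinv _ _ ⟨-1, by norm_num, ?_⟩
    exact Prod.ext (planeCircle_pi p) (planeCircle_pi q)
  -- the scalar relating `s` to the loop, which changes sign between `0` and `π`
  let g : ℝ → ℝ := fun θ => (s (nullCircle p q θ)).1 0 * Real.cos θ +
    (s (nullCircle p q θ)).1 1 * Real.sin θ
  have hg : Continuous g :=
    (((continuous_apply 0).comp (continuous_fst.comp hcont)).mul Real.continuous_cos).add
      (((continuous_apply 1).comp (continuous_fst.comp hcont)).mul Real.continuous_sin)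
  have hg_ne : ∀ θ, g θ ≠ 0 := by
    intro θ
    obtain ⟨c, hc, h⟩ := hmul (nullCircle p q θ)
    have h0 : (s (nullCircle p q θ)).1 0 = c * Real.cos θ := by rw [h]; rfl
    have h1 : (s (nullCircle p q θ)).1 1 = c * Real.sin θ := by rw [h]; rfl
    have : g θ = c := by
      simp only [g, h0, h1]
      linear_combination c * Real.sin_sq_add_cos_sq θ
    rwa [this]
  have hg_pi : g Real.pi = -g 0 := by simp [g, hpi]
  obtain ⟨θ, hθ⟩ : (0 : ℝ) ∈ Set.range g := by
    rcases le_total (g 0) 0 with h | h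
    · exact mem_range_of_exists_le_of_exists_ge hg ⟨0, h⟩ ⟨Real.pi, by linarith⟩
    · exact mem_range_of_exists_le_of_exists_ge hg ⟨Real.pi, by linarith⟩ ⟨0, h⟩
  exact hg_ne θ hθ
end
end
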